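/- Let λ(z) = (1 − √(1 − z²))/z for z ∈ (0,1). Then for every θ > 0, lim_{b→∞} (λ(e^{−θ/b²}))^b = e^{−√(2θ)}. -/

import Mathlib

open MeasureTheory ProbabilityTheory Filter Real Topology
open scoped ProbabilityTheory ENNReal

/-- `λ(z) = (1 − √(1 − z²))/z`. -/
noncomputable def lam (z : ℝ) : ℝ := (1 - Real.sqrt (1 - z ^ 2)) / z

lemma tendsto_sq_mul_one_sub_exp_div_sq (c : ℝ) :
    Tendsto (fun b : ℝ => b ^ 2 * (1 - Real.exp (c / b ^ 2))) atTop (𝓝 (-c)) := by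
  have hd : HasDerivAt (fun t : ℝ => 1 - Real.exp (c * t)) (-c) 0 := by
    simpa using (((hasDerivAt_id (0 : ℝ)).const_mul c).exp).const_sub 1
  have ht : Tendsto (fun b : ℝ => (b ^ 2)⁻¹) atTop (𝓝[≠] 0) := by
    refine tendsto_nhdsWithin_iff.2 ⟨(tendsto_pow_atTop two_ne_zero).inv_tendsto_atTop, ?_⟩
    filter_upwards [eventually_gt_atTop 0] with b hb
    have : (b ^ 2)⁻¹ ≠ 0 := by positivity
    simpa using this
  refine ((hasDerivAt_iff_tendsto_slope_zero.1 hd).comp ht).congr fun b => ?_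
  simp [div_eq_mul_inv]

/-- For every `θ > 0`, `lim_{b→∞} (λ(e^{−θ/b²}))^b = e^{−√(2θ)}`. -/
theorem lam_rpow_tendsto (θ : ℝ) (hθ : 0 < θ) :
    Tendsto (fun b : ℝ => (lam (Real.exp (-θ / b ^ 2))) ^ b) atTop
      (𝓝 (Real.exp (-Real.sqrt (2 * θ)))) := by
  have key : Tendsto (fun b : ℝ => b * (lam (Real.exp (-θ / b ^ 2)) - 1)) atTop
      (𝓝 (-Real.sqrt (2 * θ))) := by
    have hz : Tendsto (fun b : ℝ => Real.exp (-θ / b ^ 2)) atTop (𝓝 1) := by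
      have h : Tendsto (fun b : ℝ => -θ / b ^ 2) atTop (𝓝 0) :=
        tendsto_const_nhds.div_atTop (tendsto_pow_atTop two_ne_zero)
      simpa using h.rexp
    have h_lin := (tendsto_sq_mul_one_sub_exp_div_sq (-θ)).mul tendsto_inv_atTop_zero
    have h_sqrt := (tendsto_sq_mul_one_sub_exp_div_sq (-(2 * θ))).sqrt
    have h := (h_lin.sub h_sqrt).div hz one_ne_zero
    simp only [mul_zero, neg_neg, zero_sub, div_one] at h
    refine h.congr' ?_
    filter_upwards [eventually_gt_atTop 0] with b hb
    have hsq : Real.exp (-(2 * θ) / b ^ 2) = Real.exp (-θ / b ^ 2) ^ 2 := by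
      rw [← Real.exp_nat_mul]
      congr 1
      push_cast
      ring
    simp only [Pi.div_apply, lam]
    rw [hsq, Real.sqrt_mul (sq_nonneg b), Real.sqrt_sq hb.le]
    have hpos := Real.exp_ne_zero (-θ / b ^ 2)
    generalize Real.exp (-θ / b ^ 2) = z at *
    field_simp
    ring
  simpa using Real.tendsto_one_add_rpow_exp_of_tendsto key
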